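/- Let Y be a random vector distributed uniformly on the unit sphere S^{d-1} of ℝ^d, and let Z = (Y_1, Y_2, …, Y_k) be the projection of Y onto its first k coordinates, where k < d. Then for any real α with 0 < α < 1, the probability that (d/k)·‖Z‖₂² ≤ α is at most exp((k/2)·(1 − α + log α)). -/

import Mathlib

open MeasureTheory

section JLHelpers

open ProbabilityTheory

/-- The characteristic function of a rotation-invariant measure is radial. -/
lemma jl_charFun_radial {d : ℕ} (μ : Measure (EuclideanSpace ℝ (Fin d)))
    (hrot : ∀ O : EuclideanSpace ℝ (Fin d) ≃ₗᵢ[ℝ] EuclideanSpace ℝ (Fin d), μ.map O = μ)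
    (s t : EuclideanSpace ℝ (Fin d)) (h : ‖s‖ = ‖t‖) : charFun μ s = charFun μ t := by
  have h1 := Submodule.reflection_sub h
  set O := Submodule.reflection (Submodule.span ℝ {s - t})ᗮ with hO
  conv_rhs => rw [← hrot O]
  rw [charFun_apply, charFun_apply, integral_map]
  · refine integral_congr_ae (Filter.Eventually.of_forall fun x => ?_)
    simp only
    rw [← h1, LinearIsometryEquiv.inner_map_map]
  · exact O.continuous.measurable.aemeasurable
  · exact Measurable.aestronglyMeasurable (by fun_prop)

/-- Uniqueness of the rotation-invariant probability measure on the sphere. -/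
lemma jl_unique {d : ℕ} (μ ν : Measure (EuclideanSpace ℝ (Fin d)))
    [IsProbabilityMeasure μ] [IsProbabilityMeasure ν]
    (hμ : ∀ᵐ x ∂μ, ‖x‖ = 1) (hν : ∀ᵐ x ∂ν, ‖x‖ = 1)
    (hrμ : ∀ O : EuclideanSpace ℝ (Fin d) ≃ₗᵢ[ℝ] EuclideanSpace ℝ (Fin d), μ.map O = μ)
    (hrν : ∀ O : EuclideanSpace ℝ (Fin d) ≃ₗᵢ[ℝ] EuclideanSpace ℝ (Fin d), ν.map O = ν) :
    μ = ν := by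
  apply Measure.ext_of_charFun
  ext t
  have key : ∀ (μ ν : Measure (EuclideanSpace ℝ (Fin d)))
      [IsProbabilityMeasure μ] [IsProbabilityMeasure ν], (∀ᵐ x ∂ν, ‖x‖ = 1) →
      (∀ O : EuclideanSpace ℝ (Fin d) ≃ₗᵢ[ℝ] EuclideanSpace ℝ (Fin d), μ.map O = μ) →
      charFun μ t = ∫ y, charFun μ (‖t‖ • y) ∂ν := by
    intro μ ν _ _ hν hr
    have : ∫ y, charFun μ (‖t‖ • y) ∂ν = ∫ y, charFun μ t ∂ν := by
      refine integral_congr_ae ?_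
      filter_upwards [hν] with y hy
      apply jl_charFun_radial μ hr
      rw [norm_smul, hy]
      simp
    rw [this]
    simp
  rw [key μ ν hν hrμ, key ν μ hμ hrν]
  simp only [charFun_apply]
  rw [integral_integral_swap]
  · refine integral_congr_ae (Filter.Eventually.of_forall fun x => ?_)
    refine integral_congr_ae (Filter.Eventually.of_forall fun y => ?_)
    simp only [inner_smul_right]
    rw [real_inner_comm]
  · refine Integrable.of_bound (C := 1) (Measurable.aestronglyMeasurable (by fun_prop)) ?_
    refine Filter.Eventually.of_forall fun x => ?_
    simp only [Function.uncurry]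
    rw [Complex.norm_exp_ofReal_mul_I]

lemma jl_gauss_sq (c : ℝ) (hc : c < 1 / 2) :
    ∫ x, Real.exp (c * x ^ 2) ∂(gaussianReal 0 1) = (√(1 - 2 * c))⁻¹ := by
  rw [integral_gaussianReal_eq_integral_smul one_ne_zero]
  have : ∀ x : ℝ, gaussianPDFReal 0 1 x • Real.exp (c * x ^ 2)
      = (√(2 * Real.pi))⁻¹ * Real.exp (-(1 / 2 - c) * x ^ 2) := by
    intro x
    simp only [gaussianPDFReal, smul_eq_mul, NNReal.coe_one, mul_one, sub_zero]
    rw [mul_assoc, ← Real.exp_add]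
    ring_nf
  simp_rw [this]
  rw [integral_const_mul, integral_gaussian]
  have hpi := Real.pi_pos
  have h2 : 0 < 1 - 2 * c := by linarith
  rw [← Real.sqrt_inv, ← Real.sqrt_inv, ← Real.sqrt_mul (by positivity)]
  congr 1
  have h3 : 1 / 2 - c ≠ 0 := by linarith
  have h4 : 1 - 2 * c ≠ 0 := h2.ne'
  have h5 : 1 / 2 - c = (1 - 2 * c) / 2 := by ring
  rw [h5]
  field_simp

lemma jl_gauss_integrable (c : ℝ) (hc : c < 1 / 2) :
    Integrable (fun x => Real.exp (c * x ^ 2)) (gaussianReal 0 1) := by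
  by_contra h
  have h1 := jl_gauss_sq c hc
  rw [integral_undef h] at h1
  have : 0 < √(1 - 2 * c) := Real.sqrt_pos.2 (by linarith)
  have := inv_pos.2 this
  linarith

/-- Chernoff bound for a diagonal quadratic form in Gaussian variables. -/
lemma jl_chernoff {d : ℕ} (c e : Fin d → ℝ) (hc : ∀ i, c i < 1 / 2)
    (he : ∀ i, (√(1 - 2 * c i))⁻¹ ≤ Real.exp (e i)) :
    stdGaussian (EuclideanSpace ℝ (Fin d)) {x | 0 ≤ ∑ i, c i * (x i) ^ 2}
      ≤ ENNReal.ofReal (Real.exp (∑ i, e i)) := by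
  rw [← map_pi_eq_stdGaussian, Measure.map_apply (by fun_prop)
    (measurableSet_le (by fun_prop) (by fun_prop))]
  have hint : Integrable (fun x : Fin d → ℝ => ∏ i, Real.exp (c i * (x i) ^ 2))
      (Measure.pi (fun _ => gaussianReal 0 1)) :=
    Integrable.fintype_prod (f := fun i x => Real.exp (c i * x ^ 2))
      (fun i => jl_gauss_integrable (c i) (hc i))
  have hval := integral_fintype_prod_eq_prod (𝕜 := ℝ) (ι := Fin d)
    (μ := fun _ => gaussianReal 0 1) (fun i x => Real.exp (c i * x ^ 2))
  calc _ ≤ ∫⁻ x : Fin d → ℝ, ENNReal.ofReal (∏ i, Real.exp (c i * (x i) ^ 2))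
        ∂(Measure.pi (fun _ => gaussianReal 0 1)) := by
        refine meas_le_lintegral₀ hint.1.aemeasurable.ennreal_ofReal ?_
        intro x hx
        simp only [Set.mem_preimage, Set.mem_ofPred_eq] at hx
        rw [← Real.exp_sum, ENNReal.one_le_ofReal]
        exact Real.one_le_exp hx
    _ = ENNReal.ofReal (∏ i, (√(1 - 2 * c i))⁻¹) := by
        rw [← ofReal_integral_eq_lintegral_ofReal hint
          (Filter.Eventually.of_forall fun x => by positivity), hval]
        simp_rw [fun i => jl_gauss_sq (c i) (hc i)]
    _ ≤ _ := by
        rw [Real.exp_sum]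
        exact ENNReal.ofReal_le_ofReal
          (Finset.prod_le_prod (fun i _ => by positivity) (fun i _ => he i))

lemma jl_gauss_ne_zero {d : ℕ} (hd : 0 < d) :
    ∀ᵐ x ∂(stdGaussian (EuclideanSpace ℝ (Fin d))), x ≠ 0 := by
  rw [← map_pi_eq_stdGaussian, ae_map_iff (by fun_prop)
    (p := fun x : EuclideanSpace ℝ (Fin d) => x ≠ 0) (measurableSet_singleton _).compl]
  haveI := nullSingletonClass_gaussianReal (μ := 0) (v := 1) one_ne_zero
  have hev : ∀ᵐ y ∂(gaussianReal 0 1), y ≠ 0 := by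
    rw [ae_iff]
    simp
  have := (measurePreserving_eval (fun _ : Fin d => gaussianReal 0 1) ⟨0, hd⟩).quasiMeasurePreserving.ae hev
  filter_upwards [this] with x hx h0
  apply hx
  simpa using congrArg (fun z : EuclideanSpace ℝ (Fin d) => z ⟨0, hd⟩) h0

/-- A rotation-invariant probability measure on the sphere is the normalised Gaussian. -/
lemma jl_eq_normalised {d : ℕ} (hd : 0 < d)
    (μ : Measure (EuclideanSpace ℝ (Fin d))) [IsProbabilityMeasure μ]
    (hμ : ∀ᵐ x ∂μ, ‖x‖ = 1)
    (hrot : ∀ O : EuclideanSpace ℝ (Fin d) ≃ₗᵢ[ℝ] EuclideanSpace ℝ (Fin d), μ.map O = μ) :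
    μ = (stdGaussian (EuclideanSpace ℝ (Fin d))).map (fun x => ‖x‖⁻¹ • x) := by
  have hm : Measurable (fun x : EuclideanSpace ℝ (Fin d) => ‖x‖⁻¹ • x) := by fun_prop
  haveI : IsProbabilityMeasure
      ((stdGaussian (EuclideanSpace ℝ (Fin d))).map (fun x => ‖x‖⁻¹ • x)) :=
    Measure.isProbabilityMeasure_map hm.aemeasurable
  apply jl_unique _ _ hμ _ hrot
  · intro O
    rw [Measure.map_map O.continuous.measurable hm]
    have h : (O ∘ fun x : EuclideanSpace ℝ (Fin d) => ‖x‖⁻¹ • x)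
        = (fun x => ‖x‖⁻¹ • x) ∘ O := by
      ext1 x
      simp
    rw [h, ← Measure.map_map hm O.continuous.measurable, stdGaussian_map]
  · rw [ae_map_iff hm.aemeasurable (measurableSet_eq_fun (by fun_prop) (by fun_prop))]
    filter_upwards [jl_gauss_ne_zero hd] with x hx
    rw [norm_smul, norm_inv, norm_norm, inv_mul_cancel₀ (norm_ne_zero_iff.2 hx)]

lemma jl_sum_split {d k : ℕ} (hkd : k < d) (f : Fin d → ℝ) :
    ∑ j : Fin k, f (Fin.castLE hkd.le j) = ∑ i : Fin d, if (i : ℕ) < k then f i else 0 := by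
  rw [← Finset.sum_filter]
  symm
  refine Finset.sum_bij' (fun i hi => (⟨i, by simpa using hi⟩ : Fin k))
    (fun j _ => Fin.castLE hkd.le j) ?_ ?_ ?_ ?_ ?_ <;> simp

end JLHelpers

/-- Johnson–Lindenstrauss concentration lemma. Let `μ` be the uniform distribution on the
unit sphere `S^{d-1} ⊂ ℝ^d`, i.e. the rotation-invariant probability measure supported on the
sphere, and let `Z` denote the projection onto the first `k < d` coordinates. Then for any
`0 < α < 1`, `μ {y | (d/k)·‖Z y‖₂² ≤ α} ≤ exp ((k/2)·(1 − α + log α))`. -/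
theorem jl_concentration (d k : ℕ) (hk : 0 < k) (hkd : k < d)
    (μ : Measure (EuclideanSpace ℝ (Fin d))) [IsProbabilityMeasure μ]
    (hsphere : μ (Metric.sphere (0 : EuclideanSpace ℝ (Fin d)) 1)ᶜ = 0)
    (hrot : ∀ O : EuclideanSpace ℝ (Fin d) ≃ₗᵢ[ℝ] EuclideanSpace ℝ (Fin d),
      μ.map O = μ)
    (α : ℝ) (hα0 : 0 < α) (hα1 : α < 1) :
    μ {y : EuclideanSpace ℝ (Fin d) |
        (d : ℝ) / k * ∑ j : Fin k, (y (Fin.castLE hkd.le j)) ^ 2 ≤ α}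
      ≤ ENNReal.ofReal (Real.exp ((k : ℝ) / 2 * (1 - α + Real.log α))) := by
  have hd : 0 < d := by omega
  have hμ : ∀ᵐ x ∂μ, ‖x‖ = 1 := by
    rw [ae_iff]
    convert hsphere using 2
    ext x
    simp
  have hk' : (0 : ℝ) < k := by exact_mod_cast hk
  have hkd' : (k : ℝ) < d := by exact_mod_cast hkd
  have hdk : (0 : ℝ) < d - k := by linarith
  have hD : (0 : ℝ) < d - k * α := by nlinarith
  set t : ℝ := (1 - α) / (2 * α * (d - k * α)) with ht
  have ht0 : 0 < t := div_pos (by linarith) (by positivity)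
  have htD : t * (2 * α * (d - k * α)) = 1 - α :=
    div_mul_cancel₀ _ (by positivity)
  let c : Fin d → ℝ := fun i => t * (k * α - if (i : ℕ) < k then (d : ℝ) else 0)
  let e : Fin d → ℝ := fun i =>
    k * (1 - α) / (2 * (d - k)) + if (i : ℕ) < k then Real.log α / 2 - k * (1 - α) / (2 * (d - k)) else 0
  have hc1 : ∀ i : Fin d, (i : ℕ) < k → 1 - 2 * c i = α⁻¹ := by
    intro i hi
    apply eq_inv_of_mul_eq_one_left
    simp only [c, hi, if_true]
    linear_combination htD
  have hc2 : ∀ i : Fin d, ¬ (i : ℕ) < k → 1 - 2 * c i = (1 + k * (1 - α) / (d - k))⁻¹ := by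
    intro i hi
    have h1 : 1 + k * (1 - α) / (d - k) = (d - k * α) / (d - k) := by
      field_simp
      ring
    rw [h1]
    apply eq_inv_of_mul_eq_one_left
    rw [← mul_div_assoc, div_eq_one_iff_eq hdk.ne']
    simp only [c, hi, if_false]
    linear_combination (-(k : ℝ)) * htD
  have hpos : 0 < 1 + k * (1 - α) / (d - k) := by
    have : 0 < 1 - α := by linarith
    positivity
  have hc : ∀ i, c i < 1 / 2 := by
    intro i
    by_cases hi : (i : ℕ) < k
    · have := hc1 i hi
      have : 0 < α⁻¹ := by positivity
      linarith
    · have := hc2 i hi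
      have := inv_pos.2 hpos
      linarith
  have he : ∀ i, (√(1 - 2 * c i))⁻¹ ≤ Real.exp (e i) := by
    intro i
    rw [← Real.sqrt_inv]
    apply Real.sqrt_le_iff.2 ⟨(Real.exp_pos _).le, ?_⟩
    rw [← Real.exp_nat_mul]
    by_cases hi : (i : ℕ) < k
    · rw [hc1 i hi, inv_inv]
      have : ((2 : ℕ) : ℝ) * e i = Real.log α := by
        simp only [e, hi, if_true]
        push_cast
        ring
      rw [this, Real.exp_log hα0]
    · rw [hc2 i hi, inv_inv]
      have : ((2 : ℕ) : ℝ) * e i = k * (1 - α) / (d - k) := by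
        simp only [e, hi, if_false]
        push_cast
        field_simp
        ring
      rw [this, add_comm]
      exact Real.add_one_le_exp _
  have hsum : ∑ i, e i = (k : ℝ) / 2 * (1 - α + Real.log α) := by
    simp only [e]
    rw [Finset.sum_add_distrib, ← jl_sum_split hkd
      (fun _ => Real.log α / 2 - k * (1 - α) / (2 * (d - k)))]
    simp only [Finset.sum_const, Finset.card_univ, Fintype.card_fin, nsmul_eq_mul]
    field_simp
    ring
  have hmeas : MeasurableSet {y : EuclideanSpace ℝ (Fin d) |
        (d : ℝ) / k * ∑ j : Fin k, (y (Fin.castLE hkd.le j)) ^ 2 ≤ α} :=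
    measurableSet_le (by fun_prop) (by fun_prop)
  rw [← hsum, jl_eq_normalised hd μ hμ hrot, Measure.map_apply (by fun_prop) hmeas]
  refine le_trans (measure_mono_ae ?_) (jl_chernoff c e hc he)
  filter_upwards [jl_gauss_ne_zero hd] with x hx hxs
  have hn : 0 < ‖x‖ := norm_pos_iff.2 hx
  have h1 : (d : ℝ) / k * ∑ j : Fin k, ((‖x‖⁻¹ • x) (Fin.castLE hkd.le j)) ^ 2 ≤ α := hxs
  change 0 ≤ ∑ i, c i * (x i) ^ 2
  have h2 : ∑ i, c i * (x i) ^ 2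
      = t * (k * α * ‖x‖ ^ 2 - d * ∑ j : Fin k, (x (Fin.castLE hkd.le j)) ^ 2) := by
    rw [jl_sum_split hkd (fun i => (x i) ^ 2), EuclideanSpace.real_norm_sq_eq,
      Finset.mul_sum, Finset.mul_sum, ← Finset.sum_sub_distrib, Finset.mul_sum]
    refine Finset.sum_congr rfl fun i _ => ?_
    simp only [c]
    split_ifs <;> ring
  rw [h2]
  apply mul_nonneg ht0.le
  simp only [PiLp.smul_apply, smul_eq_mul, mul_pow, ← Finset.mul_sum] at h1
  have h3 : (d : ℝ) / k * ((‖x‖⁻¹) ^ 2 * ∑ j : Fin k, (x (Fin.castLE hkd.le j)) ^ 2)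
      = (d * ∑ j : Fin k, (x (Fin.castLE hkd.le j)) ^ 2) / (k * ‖x‖ ^ 2) := by
    field_simp
  rw [h3, div_le_iff₀ (by positivity)] at h1
  linarith
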